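/- Let k be a field and consider the three subfields of K = k((x))((t)) given by F = k((t))(x) (rational functions in x over Laurent series in t), F₁ = Frac(k[[x]][[t]]), and F₀ = Frac(k[x⁻¹][[t]]), each with its natural embedding into K. Then F₁ ∩ F₀ = F inside K. -/

import Mathlib

/-- The natural embedding of `k[[x]][[t]]` into `k((x))((t))`. -/
noncomputable def stmt19Phi1 (k : Type*) [Field k] :
    PowerSeries (PowerSeries k) →+* LaurentSeries (LaurentSeries k) :=
  (HahnSeries.ofPowerSeries ℤ (LaurentSeries k)).comp
    (PowerSeries.map (HahnSeries.ofPowerSeries ℤ k))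

/-- The natural embedding of `k[x⁻¹][[t]]` into `k((x))((t))`, sending the polynomial
variable to `x⁻¹`. -/
noncomputable def stmt19Phi0 (k : Type*) [Field k] :
    PowerSeries (Polynomial k) →+* LaurentSeries (LaurentSeries k) :=
  (HahnSeries.ofPowerSeries ℤ (LaurentSeries k)).comp
    (PowerSeries.map
      ((Polynomial.aeval (HahnSeries.single (-1 : ℤ) (1 : k) : LaurentSeries k)).toRingHom))


open PowerSeries in
/-- Abstract division with remainder, performed degree by degree in `t`. -/
theorem stmt19_div {A : Type*} [CommRing A] (V : AddSubgroup A) (b : PowerSeries A)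
    (h : ∀ f : A, ∃ q, f - q * constantCoeff b ∈ V) (f : PowerSeries A) :
    ∃ q : PowerSeries A, ∀ n, coeff n (f - q * b) ∈ V := by
  choose g hg using h
  let q : ℕ → A := fun n => Nat.strongRec (motive := fun _ => A)
    (fun n ih => g (coeff n f - ∑ i : Fin n, ih i i.2 * coeff (n - i) b)) n
  have hq : ∀ n, q n = g (coeff n f - ∑ i : Fin n, q i * coeff (n - i) b) := by
    intro n
    simp only [q]
    rw [Nat.strongRec_eq]
  refine ⟨PowerSeries.mk q, fun n => ?_⟩
  have := hg (coeff n f - ∑ i : Fin n, q i * coeff (n - i) b)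
  rw [← hq, Fin.sum_univ_eq_sum_range (fun i => q i * coeff (n - i) b)] at this
  rw [map_sub, coeff_mul, Finset.Nat.sum_antidiagonal_eq_sum_range_succ_mk, Finset.sum_range_succ]
  simp only [coeff_mk, Nat.sub_self, coeff_zero_eq_constantCoeff]
  convert this using 1
  ring

open PowerSeries in
theorem stmt19_mult {A : Type*} [CommRing A] [IsDomain A] (P : ℕ → AddSubgroup A)
    (hP : ∀ n, P n ≤ P (n + 1))
    (H : ∀ b0 : A, b0 ≠ 0 → ∃ N, ∃ e ∈ P (N + 1), e ∉ P N ∧ ∀ f, ∃ q, f - q * b0 ∈ P N)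
    (b : PowerSeries A) (hb : b ≠ 0) :
    ∃ u : PowerSeries A, ∃ N, b * u ≠ 0 ∧ ∀ n, coeff n (b * u) ∈ P N := by
  obtain ⟨N, e, he, he', hd⟩ := H (constantCoeff (divXPowOrder b)) (by
    rw [constantCoeff_divXPowOrder]; exact coeff_order hb)
  obtain ⟨q, hq⟩ := stmt19_div (P N) (divXPowOrder b) hd (C e)
  have h1 : ∀ n, coeff n (q * divXPowOrder b) ∈ P (N + 1) := by
    intro n
    have h2 : q * divXPowOrder b = C e - (C e - q * divXPowOrder b) := by ring
    rw [h2, map_sub]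
    refine sub_mem ?_ (hP _ (hq n))
    rw [coeff_C]
    split_ifs
    · exact he
    · exact zero_mem _
  have h0 : q * divXPowOrder b ≠ 0 := by
    intro h
    have := hq 0
    rw [h] at this
    simp at this
    exact he' this
  refine ⟨q, N + 1, ?_, ?_⟩
  · rw [mul_comm]
    refine mul_ne_zero (left_ne_zero_of_mul h0) hb
  · intro n
    rw [← X_pow_order_mul_divXPowOrder (f := b), mul_assoc, mul_comm _ q, coeff_X_pow_mul']
    split_ifs
    · exact h1 _
    · exact zero_mem _

open PowerSeries in
theorem stmt19_mult1 {k : Type*} [Field k] (b : PowerSeries (PowerSeries k)) (hb : b ≠ 0) :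
    ∃ u : PowerSeries (PowerSeries k), ∃ N : ℕ, b * u ≠ 0 ∧
      ∀ n, ∀ j, N ≤ j → coeff j (coeff n (b * u)) = 0 := by
  refine stmt19_mult (A := PowerSeries k) (fun N =>
    { carrier := {f | ∀ j, N ≤ j → coeff j f = 0}
      add_mem' := fun {a b} ha hb j hj => by rw [map_add, ha j hj, hb j hj, add_zero]
      zero_mem' := fun j hj => by simp
      neg_mem' := fun {a} ha j hj => by rw [map_neg, ha j hj, neg_zero] }) ?_ ?_ b hb
  · intro n f hf j hj
    exact hf j (by omega)
  · intro b0 h0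
    refine ⟨b0.order.toNat, X ^ b0.order.toNat, ?_, ?_, ?_⟩
    · intro j hj
      rw [coeff_X_pow, if_neg (by omega)]
    · intro h
      have := h _ le_rfl
      simp [coeff_X_pow] at this
    · intro f
      have hdvd : X ^ b0.order.toNat ∣ f - (trunc b0.order.toNat f : PowerSeries k) := by
        rw [X_pow_dvd_iff]
        intro m hm
        rw [map_sub, Polynomial.coeff_coe, coeff_trunc, if_pos hm, sub_self]
      obtain ⟨g, hg⟩ := hdvd
      refine ⟨g * Inv_divided_by_X_pow_order h0, ?_⟩
      have h2 : g * Inv_divided_by_X_pow_order h0 * b0 = X ^ b0.order.toNat * g := by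
        have h3 := X_pow_order_mul_divXPowOrder (f := b0)
        have := Inv_divided_by_X_pow_order_leftInv h0
        linear_combination (g * X ^ b0.order.toNat) * this -
          g * Inv_divided_by_X_pow_order h0 * h3
      rw [h2, ← hg]
      intro j hj
      rw [sub_sub_cancel, Polynomial.coeff_coe, coeff_trunc, if_neg (by omega)]

open PowerSeries in
theorem stmt19_mult0 {k : Type*} [Field k] (b : PowerSeries (Polynomial k)) (hb : b ≠ 0) :
    ∃ u : PowerSeries (Polynomial k), ∃ N : ℕ, b * u ≠ 0 ∧
      ∀ n, ∀ j, N ≤ j → (coeff n (b * u)).coeff j = 0 := by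
  refine stmt19_mult (A := Polynomial k) (fun N =>
    { carrier := {f | ∀ j, N ≤ j → f.coeff j = 0}
      add_mem' := fun {a b} ha hb j hj => by rw [Polynomial.coeff_add, ha j hj, hb j hj, add_zero]
      zero_mem' := fun j hj => by simp
      neg_mem' := fun {a} ha j hj => by rw [Polynomial.coeff_neg, ha j hj, neg_zero] }) ?_ ?_ b hb
  · intro n f hf j hj
    exact hf j (by omega)
  · intro b0 h0
    refine ⟨b0.natDegree, Polynomial.X ^ b0.natDegree, ?_, ?_, ?_⟩
    · intro j hj
      rw [Polynomial.coeff_X_pow, if_neg (by omega)]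
    · intro h
      have := h _ le_rfl
      simp [Polynomial.coeff_X_pow] at this
    · intro f
      refine ⟨f / b0, ?_⟩
      have h2 : f - f / b0 * b0 = f % b0 := by
        have := EuclideanDomain.div_add_mod f b0
        linear_combination -this
      rw [h2]
      intro j hj
      apply Polynomial.coeff_eq_zero_of_degree_lt
      refine lt_of_lt_of_le (Polynomial.degree_mod_lt f h0) ?_
      exact Polynomial.degree_le_natDegree.trans (by exact_mod_cast hj)

/-- All `x`-exponents are at least `N`. -/
def stmt19LB {k : Type*} [Field k] (N : ℤ) (w : LaurentSeries (LaurentSeries k)) : Prop :=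
  ∀ n j, (w.coeff n).coeff j ≠ 0 → N ≤ j

/-- All `x`-exponents are at most `N`. -/
def stmt19UB {k : Type*} [Field k] (N : ℤ) (w : LaurentSeries (LaurentSeries k)) : Prop :=
  ∀ n j, (w.coeff n).coeff j ≠ 0 → j ≤ N

theorem stmt19_coeff_mul {k : Type*} [Field k] (w v : LaurentSeries (LaurentSeries k)) (n j : ℤ)
    (h : ((w * v).coeff n).coeff j ≠ 0) :
    ∃ n1 j1 n2 j2, j1 + j2 = j ∧ (w.coeff n1).coeff j1 ≠ 0 ∧ (v.coeff n2).coeff j2 ≠ 0 := by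
  rw [HahnSeries.coeff_mul, HahnSeries.coeff_sum] at h
  obtain ⟨⟨n1, n2⟩, -, h⟩ := Finset.exists_ne_zero_of_sum_ne_zero h
  rw [HahnSeries.coeff_mul] at h
  obtain ⟨⟨j1, j2⟩, hj, h⟩ := Finset.exists_ne_zero_of_sum_ne_zero h
  exact ⟨n1, j1, n2, j2, by simpa using (Finset.mem_antidiagonal.1 hj).2.2,
    left_ne_zero_of_mul h, right_ne_zero_of_mul h⟩

theorem stmt19LB.mul {k : Type*} [Field k] {N M : ℤ} {w v : LaurentSeries (LaurentSeries k)}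
    (hw : stmt19LB N w) (hv : stmt19LB M v) : stmt19LB (N + M) (w * v) := by
  intro n j h
  obtain ⟨n1, j1, n2, j2, rfl, h1, h2⟩ := stmt19_coeff_mul _ _ _ _ h
  exact add_le_add (hw _ _ h1) (hv _ _ h2)

theorem stmt19UB.mul {k : Type*} [Field k] {N M : ℤ} {w v : LaurentSeries (LaurentSeries k)}
    (hw : stmt19UB N w) (hv : stmt19UB M v) : stmt19UB (N + M) (w * v) := by
  intro n j h
  obtain ⟨n1, j1, n2, j2, rfl, h1, h2⟩ := stmt19_coeff_mul _ _ _ _ h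
  exact add_le_add (hw _ _ h1) (hv _ _ h2)

theorem stmt19_coeff1 {k : Type*} [Field k] (a : PowerSeries (PowerSeries k)) (n j : ℤ)
    (h : ((stmt19Phi1 k a).coeff n).coeff j ≠ 0) :
    ∃ n' j' : ℕ, j = j' ∧ PowerSeries.coeff j' (PowerSeries.coeff n' a) ≠ 0 := by
  simp only [stmt19Phi1, RingHom.comp_apply] at h
  rw [PowerSeries.coeff_coe] at h
  split_ifs at h with hn
  · simp at h
  rw [PowerSeries.coeff_map, PowerSeries.coeff_coe] at h
  split_ifs at h with hj
  · simp at h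
  exact ⟨_, _, by omega, h⟩

theorem stmt19_algebraMap {k : Type*} [Field k] (a : k) :
    algebraMap k (LaurentSeries k) a = HahnSeries.C a := by
  rw [HahnSeries.algebraMap_apply', PowerSeries.algebraMap_apply, Algebra.algebraMap_self_apply,
    HahnSeries.ofPowerSeries_C]

theorem stmt19_term {k : Type*} [Field k] (a : k) (i : ℕ) (j : ℤ) :
    (algebraMap k (LaurentSeries k) a *
      (HahnSeries.single (-1 : ℤ) (1 : k) : LaurentSeries k) ^ i).coeff j =
      if j = -i then a else 0 := by
  rw [stmt19_algebraMap, HahnSeries.single_pow, HahnSeries.C_apply,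
    HahnSeries.single_mul_single, HahnSeries.coeff_single]
  simp

theorem stmt19_aeval {k : Type*} [Field k] (p : Polynomial k) (j : ℤ)
    (h : (Polynomial.aeval (HahnSeries.single (-1 : ℤ) (1 : k) : LaurentSeries k) p).coeff j ≠ 0) :
    ∃ j' : ℕ, j = -j' ∧ p.coeff j' ≠ 0 := by
  rw [Polynomial.aeval_def, Polynomial.eval₂_eq_sum_range, HahnSeries.coeff_sum] at h
  obtain ⟨i, -, h⟩ := Finset.exists_ne_zero_of_sum_ne_zero h
  rw [stmt19_term] at h
  simp only [ne_eq, ite_eq_right_iff, Classical.not_imp] at h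
  exact ⟨i, h⟩

theorem stmt19_coeff0 {k : Type*} [Field k] (a : PowerSeries (Polynomial k)) (n j : ℤ)
    (h : ((stmt19Phi0 k a).coeff n).coeff j ≠ 0) :
    ∃ n' j' : ℕ, j = -j' ∧ (PowerSeries.coeff n' a).coeff j' ≠ 0 := by
  simp only [stmt19Phi0, RingHom.comp_apply] at h
  rw [PowerSeries.coeff_coe] at h
  split_ifs at h with hn
  · simp at h
  rw [PowerSeries.coeff_map] at h
  exact ⟨_, stmt19_aeval _ _ h⟩

theorem stmt19_inj1 (k : Type*) [Field k] : Function.Injective (stmt19Phi1 k) := by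
  rw [stmt19Phi1, RingHom.coe_comp]
  exact HahnSeries.ofPowerSeries_injective.comp
    (PowerSeries.map_injective _ HahnSeries.ofPowerSeries_injective)

theorem stmt19_inj0 (k : Type*) [Field k] : Function.Injective (stmt19Phi0 k) := by
  rw [stmt19Phi0, RingHom.coe_comp]
  refine HahnSeries.ofPowerSeries_injective.comp (PowerSeries.map_injective _ ?_)
  rw [injective_iff_map_eq_zero]
  intro p hp
  ext i
  have h2 : (Polynomial.aeval (HahnSeries.single (-1 : ℤ) (1 : k) : LaurentSeries k) p).coeff (-i)
      = 0 := by
    have : Polynomial.aeval (HahnSeries.single (-1 : ℤ) (1 : k) : LaurentSeries k) p = 0 := hp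
    rw [this]; rfl
  rw [Polynomial.aeval_def, Polynomial.eval₂_eq_sum_range, HahnSeries.coeff_sum] at h2
  simp only [stmt19_term, neg_inj, Nat.cast_inj] at h2
  rw [Finset.sum_ite_eq] at h2
  split_ifs at h2 with hi
  · simpa using h2
  · rw [Polynomial.coeff_zero]
    apply Polynomial.coeff_eq_zero_of_natDegree_lt
    simpa using hi

theorem stmt19_range {k : Type*} [Field k]
    (ψ : RatFunc (LaurentSeries k) →+* LaurentSeries (LaurentSeries k))
    (hX : ψ RatFunc.X = HahnSeries.C (HahnSeries.single (1 : ℤ) (1 : k)))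
    (hC : ∀ (a : LaurentSeries k) (n : ℤ),
      (ψ (RatFunc.C a)).coeff n = HahnSeries.C (a.coeff n))
    (w : LaurentSeries (LaurentSeries k)) (N M : ℤ) (h1 : stmt19LB N w) (h2 : stmt19UB M w) :
    w ∈ ψ.fieldRange := by
  let a : ℤ → LaurentSeries k := fun j =>
    { coeff := fun n => (w.coeff n).coeff j
      isPWO_support' := w.isPWO_support.mono (fun n hn hw => hn (by
        simp only at hw ⊢
        rw [hw]; rfl)) }
  have hz : ∀ j : ℤ, ψ (RatFunc.X ^ j) = HahnSeries.C (HahnSeries.single j (1 : k)) := by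
    intro j
    rw [map_zpow₀, hX, ← map_zpow₀, ← RatFunc.single_zpow]
  have : w = ψ (∑ j ∈ Finset.Icc N M, RatFunc.C (a j) * RatFunc.X ^ j) := by
    rw [map_sum]
    ext n j
    rw [HahnSeries.coeff_sum, HahnSeries.coeff_sum]
    have : ∀ i, ((ψ (RatFunc.C (a i) * RatFunc.X ^ i)).coeff n).coeff j =
        if j = i then (w.coeff n).coeff i else 0 := by
      intro i
      rw [map_mul, hz, HahnSeries.C_apply, HahnSeries.coeff_mul_single_zero, hC, HahnSeries.C_apply,
        HahnSeries.single_mul_single, HahnSeries.coeff_single]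
      simp [a]
    simp only [this]
    rw [Finset.sum_ite_eq]
    split_ifs with hj
    · rfl
    · by_contra h
      exact hj (Finset.mem_Icc.2 ⟨h1 _ _ h, h2 _ _ h⟩)
  rw [this]
  exact ⟨_, rfl⟩

theorem stmt19_closure {A K : Type*} [CommRing A] [Field K] (φ : A →+* K) (z : K)
    (hz : z ∈ Subfield.closure (φ.range : Set K)) : ∃ a b, φ b ≠ 0 ∧ z = φ a / φ b := by
  rw [Subfield.mem_closure_iff, Subring.closure_eq] at hz
  obtain ⟨_, ⟨a, rfl⟩, _, ⟨b, rfl⟩, rfl⟩ := hz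
  by_cases h : φ b = 0
  · exact ⟨0, 1, by simp, by simp [h]⟩
  · exact ⟨a, b, h, rfl⟩

theorem stmt19_sub {k : Type*} [Field k]
    (ψ : RatFunc (LaurentSeries k) →+* LaurentSeries (LaurentSeries k))
    (hC : ∀ (a : LaurentSeries k) (n : ℤ),
      (ψ (RatFunc.C a)).coeff n = HahnSeries.C (a.coeff n))
    (S : Subfield (LaurentSeries (LaurentSeries k)))
    (hXS : ψ RatFunc.X ∈ S)
    (hS : ∀ f : PowerSeries k, HahnSeries.ofPowerSeries ℤ (LaurentSeries k)
      (PowerSeries.map HahnSeries.C f) ∈ S) (r : RatFunc (LaurentSeries k)) : ψ r ∈ S := by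
  have h1 : ∀ f : PowerSeries k, ψ (RatFunc.C (HahnSeries.ofPowerSeries ℤ k f)) ∈ S := by
    intro f
    convert hS f using 1
    ext n : 2
    rw [hC, PowerSeries.coeff_coe, PowerSeries.coeff_coe]
    split_ifs
    · simp
    · simp
  have h2 : ∀ a : LaurentSeries k, ψ (RatFunc.C a) ∈ S := by
    intro a
    rw [← a.single_order_mul_powerSeriesPart, map_mul, map_mul, RatFunc.single_zpow,
      map_zpow₀, map_zpow₀, ← HahnSeries.ofPowerSeries_X]
    exact mul_mem (zpow_mem (h1 _) _) (h1 _)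
  have h3 : ∀ p : Polynomial (LaurentSeries k), ψ (algebraMap _ _ p) ∈ S := by
    intro p
    induction p using Polynomial.induction_on' with
    | add p q hp hq => rw [map_add, map_add]; exact add_mem hp hq
    | monomial n a =>
      rw [← Polynomial.C_mul_X_pow_eq_monomial, map_mul, map_mul, map_pow, map_pow,
        RatFunc.algebraMap_X, RatFunc.algebraMap_C]
      exact mul_mem (h2 a) (pow_mem hXS _)
  induction r using RatFunc.induction_on with
  | f p q hq => rw [map_div₀]; exact div_mem (h3 p) (h3 q)

/-- Inside `K = k((x))((t))`, the intersection of `F₁ = Frac(k[[x]][[t]])` and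
`F₀ = Frac(k[x⁻¹][[t]])` is exactly `F = k((t))(x)`, where `k((t))(x)` is embedded via
any ring homomorphism `ψ` sending `X` to `x` and acting coefficientwise as the constant
embedding on `k((t))`. -/
theorem stmt_19 (k : Type*) [Field k]
    (ψ : RatFunc (LaurentSeries k) →+* LaurentSeries (LaurentSeries k))
    (hX : ψ RatFunc.X = HahnSeries.C (HahnSeries.single (1 : ℤ) (1 : k)))
    (hC : ∀ (a : LaurentSeries k) (n : ℤ),
      (ψ (RatFunc.C a)).coeff n = HahnSeries.C (a.coeff n)) :
    {z : LaurentSeries (LaurentSeries k) | ∃ a b : PowerSeries (PowerSeries k),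
        stmt19Phi1 k b ≠ 0 ∧ z = stmt19Phi1 k a / stmt19Phi1 k b} ∩
      {z : LaurentSeries (LaurentSeries k) | ∃ c d : PowerSeries (Polynomial k),
        stmt19Phi0 k d ≠ 0 ∧ z = stmt19Phi0 k c / stmt19Phi0 k d} =
      Set.range ψ := by
  apply Set.Subset.antisymm
  · rintro z ⟨⟨a, b, hb, h1⟩, ⟨c, d, hd, h0⟩⟩
    have hb' : b ≠ 0 := fun h => hb (by rw [h, map_zero])
    have hd' : d ≠ 0 := fun h => hd (by rw [h, map_zero])
    obtain ⟨u, N, hu, hN⟩ := stmt19_mult1 b hb'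
    obtain ⟨v, M, hv, hM⟩ := stmt19_mult0 d hd'
    have hP0 : stmt19Phi1 k (b * u) ≠ 0 := (map_ne_zero_iff _ (stmt19_inj1 k)).2 hu
    have hQ0 : stmt19Phi0 k (d * v) ≠ 0 := (map_ne_zero_iff _ (stmt19_inj0 k)).2 hv
    have L1 : ∀ f, stmt19LB 0 (stmt19Phi1 k f) := by
      intro f n j h
      obtain ⟨n', j', rfl, -⟩ := stmt19_coeff1 _ _ _ h
      omega
    have U0 : ∀ f, stmt19UB 0 (stmt19Phi0 k f) := by
      intro f n j h
      obtain ⟨n', j', rfl, -⟩ := stmt19_coeff0 _ _ _ h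
      omega
    have UP : stmt19UB N (stmt19Phi1 k (b * u)) := by
      intro n j h
      obtain ⟨n', j', rfl, h'⟩ := stmt19_coeff1 _ _ _ h
      by_contra hj
      exact h' (hN _ _ (by omega))
    have LQ : stmt19LB (-M) (stmt19Phi0 k (d * v)) := by
      intro n j h
      obtain ⟨n', j', rfl, h'⟩ := stmt19_coeff0 _ _ _ h
      by_contra hj
      exact h' (hM _ _ (by omega))
    have hW : stmt19Phi1 k (a * u) * stmt19Phi0 k (d * v) =
        stmt19Phi0 k (c * v) * stmt19Phi1 k (b * u) := by
      have h := h1.symm.trans h0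
      rw [div_eq_div_iff hb hd] at h
      simp only [map_mul]
      linear_combination (stmt19Phi1 k u * stmt19Phi0 k v) * h
    have hz : z = (stmt19Phi1 k (a * u) * stmt19Phi0 k (d * v)) /
        (stmt19Phi1 k (b * u) * stmt19Phi0 k (d * v)) := by
      rw [mul_div_mul_right _ _ hQ0, map_mul, map_mul, mul_div_mul_right _ _ ?_, h1]
      rw [map_mul] at hP0
      exact right_ne_zero_of_mul hP0
    have key : z ∈ ψ.fieldRange := by
      rw [hz]
      refine div_mem (stmt19_range ψ hX hC _ _ (0 + N) ((L1 _).mul LQ) ?_)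
        (mul_mem (stmt19_range ψ hX hC _ _ _ (L1 _) UP)
          (stmt19_range ψ hX hC _ _ _ LQ (U0 _)))
      rw [hW]
      exact (U0 _).mul UP
    exact key
  · rintro _ ⟨r, rfl⟩
    refine ⟨stmt19_closure _ _ (stmt19_sub ψ hC _ ?_ ?_ r),
      stmt19_closure _ _ (stmt19_sub ψ hC _ ?_ ?_ r)⟩
    · refine Subfield.subset_closure ⟨PowerSeries.C PowerSeries.X, ?_⟩
      rw [hX, stmt19Phi1, RingHom.comp_apply, PowerSeries.map_C, HahnSeries.ofPowerSeries_C,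
        HahnSeries.ofPowerSeries_X]
    · intro f
      refine Subfield.subset_closure ⟨PowerSeries.map PowerSeries.C f, ?_⟩
      rw [stmt19Phi1, RingHom.comp_apply]
      congr 1
      ext n : 1
      simp [PowerSeries.coeff_map]
    · have h : stmt19Phi0 k (PowerSeries.C Polynomial.X) = (ψ RatFunc.X)⁻¹ := by
        rw [hX, ← map_inv₀, stmt19Phi0, RingHom.comp_apply, PowerSeries.map_C,
          HahnSeries.ofPowerSeries_C]
        congr 1
        simp
      rw [← inv_inv (ψ RatFunc.X), ← h]
      exact inv_mem (Subfield.subset_closure ⟨_, rfl⟩)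
    · intro f
      refine Subfield.subset_closure ⟨PowerSeries.map Polynomial.C f, ?_⟩
      rw [stmt19Phi0, RingHom.comp_apply]
      congr 1
      ext n : 1
      simp [PowerSeries.coeff_map]
      exact stmt19_algebraMap _
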